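/- Let F : ℝⁿ → ℝⁿ and g₁,…,g_m be real polynomials, let X = {x : gᵢ(x) ≥ 0 (i ∈ I), gᵢ(x) = 0 (i ∈ E)}, and suppose there is an m×(n+m) matrix L(x) of real polynomials with L(x)G(x) = I_m for all x ∈ ℝⁿ. Define the polynomial Lagrange multiplier expression λ(x) := L(x)F̂(x) ∈ ℝᵐ. Then: (a) every KKT pair (x,λ) of VI(X,F) satisfies λ = λ(x); (b) a point x ∈ ℝⁿ is a KKT point of VI(X,F) if and only if F(x) = Σ_{i=1}^m λᵢ(x)∇gᵢ(x), gᵢ(x) = 0 for i ∈ E, and λᵢ(x) ≥ 0, gᵢ(x) ≥ 0, λᵢ(x)gᵢ(x) = 0 for i ∈ I; (c) every x ∈ SOL(X,F) is a KKT point, hence SOL(X,F) is contained in the set K of points satisfying the system in (b). -/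

import Mathlib

open MvPolynomial Matrix

/-- The matrix `G(x)` whose `j`-th column is `(∇gⱼ(x); gⱼ(x)eⱼ)`. -/
noncomputable def Gmat {n m : ℕ} (g : Fin m → MvPolynomial (Fin n) ℝ) (x : Fin n → ℝ) :
    Matrix (Sum (Fin n) (Fin m)) (Fin m) ℝ :=
  fun p j => Sum.elim (fun i => eval x (pderiv i (g j)))
    (fun k => eval x (g j) * (if k = j then (1 : ℝ) else 0)) p

/-- The evaluation of a polynomial is strictly differentiable, with gradient given by `pderiv`. -/
theorem MvPolynomial.hasStrictFDerivAt_eval {ι : Type*} [Fintype ι] (p : MvPolynomial ι ℝ)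
    (x : ι → ℝ) :
    HasStrictFDerivAt (fun y : ι → ℝ => eval y p)
      (∑ i, eval x (pderiv i p) • ContinuousLinearMap.proj (R := ℝ) (φ := fun _ : ι => ℝ) i) x := by
  classical
  induction p using MvPolynomial.induction_on with
  | C a => simpa using hasStrictFDerivAt_const a x
  | add p q hp hq =>
    simp only [map_add, add_smul, Finset.sum_add_distrib]
    exact hp.add hq
  | mul_X p k hp =>
    have hX : HasStrictFDerivAt (fun y : ι → ℝ => y k)
        (ContinuousLinearMap.proj (R := ℝ) (φ := fun _ : ι => ℝ) k) x :=
      (ContinuousLinearMap.proj (R := ℝ) (φ := fun _ : ι => ℝ) k).hasStrictFDerivAt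
    refine (hp.mul hX).congr_fderiv ?_ |>.congr_of_eventuallyEq (.of_forall fun y => by simp)
    ext v
    simp [pderiv_X, Pi.single_apply, add_mul, Finset.sum_add_distrib, Finset.mul_sum, apply_ite,
      mul_assoc]

/-- A curve with prescribed velocity `d` along which `Φ` varies affinely, when the derivative of
`Φ` has a right inverse. -/
theorem HasStrictFDerivAt.exists_curve {V W : Type*} [NormedAddCommGroup V] [NormedSpace ℝ V]
    [NormedAddCommGroup W] [NormedSpace ℝ W] [CompleteSpace W]
    {Φ : V → W} {A : V →L[ℝ] W} {p₀ : V} (hΦ : HasStrictFDerivAt Φ A p₀)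
    (R : W →L[ℝ] V) (hR : ∀ w, A (R w) = w) (d : V) :
    ∃ p : ℝ → V, p 0 = p₀ ∧ HasDerivAt p d 0 ∧ ∀ᶠ t in nhds 0, Φ (p t) = Φ p₀ + t • A d := by
  let B : ℝ × W →L[ℝ] V :=
    (ContinuousLinearMap.fst ℝ ℝ W).smulRight d + R.comp (ContinuousLinearMap.snd ℝ ℝ W)
  let C : ℝ × W →L[ℝ] W := (ContinuousLinearMap.fst ℝ ℝ W).smulRight (A d)
  let Ψ : ℝ × W → ℝ × W := fun q => (q.1, Φ (p₀ + B q) - C q)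
  have hB : HasStrictFDerivAt (fun q => p₀ + B q) B 0 := B.hasStrictFDerivAt.const_add p₀
  have hΦB : HasStrictFDerivAt (fun q => Φ (p₀ + B q)) (A.comp B) 0 :=
    HasStrictFDerivAt.comp (g := Φ) 0 (by simpa using hΦ) hB
  have hΨ : HasStrictFDerivAt Ψ
      ((ContinuousLinearEquiv.refl ℝ (ℝ × W) : (ℝ × W) ≃L[ℝ] (ℝ × W)) : ℝ × W →L[ℝ] ℝ × W) 0 := by
    have h : HasStrictFDerivAt Ψ ((ContinuousLinearMap.fst ℝ ℝ W).prod (A.comp B - C)) 0 :=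
      hasStrictFDerivAt_fst.prodMk (hΦB.sub C.hasStrictFDerivAt)
    convert h using 1
    ext q <;> simp [B, C, hR]
  have hΨ0 : Ψ 0 = (0, Φ p₀) := by simp [Ψ]
  let σ := hΨ.localInverse Ψ _ 0
  have hσ0 : σ (0, Φ p₀) = 0 := by rw [← hΨ0]; exact hΨ.localInverse_apply_image
  have hσ := hΨ.to_localInverse.hasFDerivAt
  rw [hΨ0] at hσ
  have hc : HasDerivAt (fun t : ℝ => (t, Φ p₀)) ((1 : ℝ), (0 : W)) 0 :=
    (hasDerivAt_id 0).prodMk (hasDerivAt_const 0 (Φ p₀))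
  have hσc : HasDerivAt (fun t : ℝ => σ (t, Φ p₀)) ((1 : ℝ), (0 : W)) 0 := by
    exact HasFDerivAt.comp_hasDerivAt (l := σ) (0 : ℝ) hσ hc
  refine ⟨fun t => p₀ + B (σ (t, Φ p₀)), by simp [hσ0], ?_, ?_⟩
  · simpa [B] using (B.hasFDerivAt.comp_hasDerivAt (0 : ℝ) hσc).const_add p₀
  · have hr : ∀ᶠ q in nhds ((0 : ℝ), Φ p₀), Ψ (σ q) = q := by
      rw [← hΨ0]; exact hΨ.eventually_right_inverse
    filter_upwards [hc.continuousAt.eventually hr] with t ht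
    have h1 : (σ (t, Φ p₀)).1 = t := congrArg Prod.fst ht
    have h2 := congrArg Prod.snd ht
    simp only [Ψ, C, ContinuousLinearMap.smulRight_apply, ContinuousLinearMap.coe_fst', h1] at h2
    exact sub_eq_iff_eq_add.mp h2

/-- A function bounded below on the right by its value `0` at the origin has nonnegative
derivative there. -/
theorem HasDerivAt.nonneg_of_eventually_nonneg {f : ℝ → ℝ} {f' : ℝ} (hf : HasDerivAt f f' 0)
    (h0 : f 0 = 0) (h : ∀ᶠ t in nhdsWithin 0 (Set.Ioi 0), 0 ≤ f t) : 0 ≤ f' := by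
  have ht := (hasDerivAt_iff_tendsto_slope.mp hf).mono_left
    (nhdsWithin_mono (s := Set.Ioi 0) 0 fun t (ht : 0 < t) => ht.ne')
  refine ge_of_tendsto ht ?_
  filter_upwards [h, self_mem_nhdsWithin] with t ht (hpos : 0 < t)
  simpa [slope_def_field, h0] using div_nonneg ht hpos.le

section Multipliers

variable {n m : ℕ} (g : Fin m → MvPolynomial (Fin n) ℝ) (x : Fin n → ℝ)

/-- `g(y) + g(x) z` in the variables `(y, z)`; its derivative at `(x, 0)` is `G(x)ᵀ`. -/
noncomputable def slackMap (p : Fin n ⊕ Fin m → ℝ) (j : Fin m) : ℝ :=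
  eval (fun i => p (Sum.inl i)) (g j) + eval x (g j) * p (Sum.inr j)

theorem transpose_Gmat_mulVec (d : Fin n ⊕ Fin m → ℝ) (j : Fin m) :
    ((Gmat g x)ᵀ *ᵥ d) j =
      ∑ i, eval x (pderiv i (g j)) * d (Sum.inl i) + eval x (g j) * d (Sum.inr j) := by
  simp [mulVec, dotProduct, Gmat]

theorem Gmat_mulVec_inl (lam : Fin m → ℝ) (i : Fin n) :
    (Gmat g x *ᵥ lam) (Sum.inl i) = ∑ j, lam j * eval x (pderiv i (g j)) := by
  simp [mulVec, dotProduct, Gmat, mul_comm]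

theorem Gmat_mulVec_inr (lam : Fin m → ℝ) (k : Fin m) :
    (Gmat g x *ᵥ lam) (Sum.inr k) = lam k * eval x (g k) := by
  simp [mulVec, dotProduct, Gmat, mul_comm]

theorem hasStrictFDerivAt_slackMap :
    HasStrictFDerivAt (slackMap g x) (Gmat g x)ᵀ.mulVecLin.toContinuousLinearMap
      (Sum.elim x 0) := by
  rw [hasStrictFDerivAt_pi']
  intro j
  let P : (Fin n ⊕ Fin m → ℝ) →L[ℝ] (Fin n → ℝ) :=
    ContinuousLinearMap.pi fun i => ContinuousLinearMap.proj (Sum.inl i)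
  let Q : (Fin n ⊕ Fin m → ℝ) →L[ℝ] ℝ := ContinuousLinearMap.proj (Sum.inr j)
  have hP : HasStrictFDerivAt (fun p => eval (P p) (g j)) _ (Sum.elim x 0) :=
    HasStrictFDerivAt.comp (g := fun y => eval y (g j)) (Sum.elim x 0)
      (MvPolynomial.hasStrictFDerivAt_eval (g j) x) P.hasStrictFDerivAt
  have hQ : HasStrictFDerivAt (fun p => eval x (g j) * Q p) _ (Sum.elim x 0) :=
    Q.hasStrictFDerivAt.const_mul (eval x (g j))
  refine (hP.add hQ).congr_fderiv (ContinuousLinearMap.ext fun d => ?_)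
  simpa [P, Q, -mulVecLin_transpose] using (transpose_Gmat_mulVec g x d j).symm

/-- A solution of the variational inequality satisfies the first-order condition in every
direction that keeps the linearised slack system feasible. -/
theorem nonneg_dotProduct_of_isSolution {E I : Set (Fin m)}
    (A : Matrix (Fin m) (Fin n ⊕ Fin m) ℝ) (hA : A * Gmat g x = 1) (c : Fin n → ℝ)
    (hxI : ∀ j ∈ I, 0 ≤ eval x (g j)) (hxE : ∀ j ∈ E, eval x (g j) = 0)
    (hsol : ∀ y : Fin n → ℝ, (∀ j ∈ I, 0 ≤ eval y (g j)) → (∀ j ∈ E, eval y (g j) = 0) →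
      0 ≤ ∑ i, (y i - x i) * c i)
    (d : Fin n ⊕ Fin m → ℝ) (hdI : ∀ j ∈ I, 0 ≤ ((Gmat g x)ᵀ *ᵥ d) j)
    (hdE : ∀ j ∈ E, ((Gmat g x)ᵀ *ᵥ d) j = 0) :
    0 ≤ d ⬝ᵥ Sum.elim c 0 := by
  obtain ⟨p, hp0, hpd, hp⟩ := (hasStrictFDerivAt_slackMap g x).exists_curve
    Aᵀ.mulVecLin.toContinuousLinearMap
    (fun w => by simp [hA]) d
  have hpi := hasDerivAt_pi.mp hpd
  have hf : HasDerivAt (fun t => ∑ i, (p t (Sum.inl i) - x i) * c i)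
      (∑ i, d (Sum.inl i) * c i) 0 :=
    HasDerivAt.fun_sum fun i _ => ((hpi (Sum.inl i)).sub_const (x i)).mul_const (c i)
  have hz : ∀ᶠ t in nhds (0 : ℝ), ∀ j, p t (Sum.inr j) < 1 := by
    refine Filter.eventually_all.mpr fun j => ?_
    refine (hpi (Sum.inr j)).continuousAt.eventually_lt continuousAt_const ?_
    simp [hp0]
  have hnonneg := hf.nonneg_of_eventually_nonneg (by simp [hp0]) <| by
    filter_upwards [nhdsWithin_le_nhds hp, nhdsWithin_le_nhds hz, self_mem_nhdsWithin]
      with t ht hzt (hpos : 0 < t)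
    have key (j : Fin m) : eval (fun i => p t (Sum.inl i)) (g j) =
        eval x (g j) * (1 - p t (Sum.inr j)) + t * ((Gmat g x)ᵀ *ᵥ d) j := by
      have h := congrFun ht j
      simp only [slackMap, Pi.add_apply, Pi.smul_apply, smul_eq_mul, Sum.elim_inl, Sum.elim_inr,
        Pi.zero_apply, mul_zero, add_zero, LinearMap.coe_toContinuousLinearMap',
        mulVecLin_apply] at h
      linarith
    refine hsol _ (fun j hj => ?_) (fun j hj => ?_)
    · rw [key]
      exact add_nonneg (mul_nonneg (hxI j hj) (sub_nonneg.mpr (hzt j).le))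
        (mul_nonneg hpos.le (hdI j hj))
    · simp [key, hxE j hj, hdE j hj]
  simpa [dotProduct] using hnonneg

/-- The multipliers `A F̂` of a solution of the variational inequality. -/
theorem Gmat_mulVec_multiplier_of_isSolution {E I : Set (Fin m)} (hEI : Disjoint E I)
    (A : Matrix (Fin m) (Fin n ⊕ Fin m) ℝ) (hA : A * Gmat g x = 1) (c : Fin n → ℝ)
    (hxI : ∀ j ∈ I, 0 ≤ eval x (g j)) (hxE : ∀ j ∈ E, eval x (g j) = 0)
    (hsol : ∀ y : Fin n → ℝ, (∀ j ∈ I, 0 ≤ eval y (g j)) → (∀ j ∈ E, eval y (g j) = 0) →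
      0 ≤ ∑ i, (y i - x i) * c i) :
    Gmat g x *ᵥ (A *ᵥ Sum.elim c 0) = Sum.elim c 0 ∧ ∀ j ∈ I, 0 ≤ (A *ᵥ Sum.elim c 0) j := by
  have key := nonneg_dotProduct_of_isSolution g x A hA c hxI hxE hsol
  have hT (w : Fin m → ℝ) : (Gmat g x)ᵀ *ᵥ (Aᵀ *ᵥ w) = w := by
    simp [mulVec_mulVec, ← transpose_mul, hA]
  have hadj (w : Fin m → ℝ) : Aᵀ *ᵥ w ⬝ᵥ Sum.elim c 0 = w ⬝ᵥ A *ᵥ Sum.elim c 0 := by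
    rw [mulVec_transpose, dotProduct_mulVec]
  constructor
  · set e : Fin n ⊕ Fin m → ℝ := Sum.elim c 0
    have hker (v : Fin n ⊕ Fin m → ℝ) : 0 ≤ v ⬝ᵥ (e - Gmat g x *ᵥ (A *ᵥ e)) := by
      have h0 : (Gmat g x)ᵀ *ᵥ (v - Aᵀ *ᵥ ((Gmat g x)ᵀ *ᵥ v)) = 0 := by
        rw [mulVec_sub, hT, sub_self]
      have h := key (v - Aᵀ *ᵥ ((Gmat g x)ᵀ *ᵥ v)) (fun j _ => (congrFun h0 j).ge)
        (fun j _ => congrFun h0 j)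
      rwa [sub_dotProduct, hadj, mulVec_transpose, ← dotProduct_mulVec, ← dotProduct_sub] at h
    have h := hker (-(e - Gmat g x *ᵥ (A *ᵥ e)))
    rw [neg_dotProduct, neg_nonneg] at h
    exact (sub_eq_zero.mp (dotProduct_self_eq_zero.mp (le_antisymm h (hker _)))).symm
  · intro j hj
    have h := key (Aᵀ *ᵥ Pi.single j 1)
      (fun k _ => by
        rw [hT]
        exact (Pi.single_nonneg (i := j).mpr zero_le_one : (0 : Fin m → ℝ) ≤ _) k)
      (fun k hk => by
        rw [hT, Pi.single_eq_of_ne]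
        exact fun h => Set.disjoint_left.mp hEI hk (h ▸ hj))
    rwa [hadj, single_one_dotProduct] at h

end Multipliers

theorem stmt10 (n m : ℕ)
    (F : Fin n → MvPolynomial (Fin n) ℝ) (g : Fin m → MvPolynomial (Fin n) ℝ)
    (E I : Set (Fin m)) (hEI : Disjoint E I) (hUnion : E ∪ I = Set.univ)
    (X : Set (Fin n → ℝ))
    (hX : X = {x | (∀ j ∈ I, 0 ≤ eval x (g j)) ∧ (∀ j ∈ E, eval x (g j) = 0)})
    (L : Matrix (Fin m) (Sum (Fin n) (Fin m)) (MvPolynomial (Fin n) ℝ))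
    (hL : ∀ x : Fin n → ℝ, (L.map (eval x)) * Gmat g x = 1)
    -- the Lagrange multiplier expression `λ(x) = L(x)·F̂(x)` with `F̂(x) = (F(x); 0)`
    (lamE : (Fin n → ℝ) → Fin m → ℝ)
    (hlamE : ∀ x, lamE x = (L.map (eval x)).mulVec
        (Sum.elim (fun i => eval x (F i)) (fun _ => 0)))
    (SOL K : Set (Fin n → ℝ))
    (hSOL : SOL = {x ∈ X | ∀ y ∈ X, 0 ≤ ∑ i, (y i - x i) * eval x (F i)})
    (hK : K = {x | (∀ i, eval x (F i) = ∑ j, lamE x j * eval x (pderiv i (g j))) ∧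
        (∀ j ∈ E, eval x (g j) = 0) ∧
        (∀ j ∈ I, 0 ≤ lamE x j ∧ 0 ≤ eval x (g j) ∧ lamE x j * eval x (g j) = 0)}) :
    -- (a) every KKT pair `(x,λ)` satisfies `λ = λ(x)`
    (∀ (x : Fin n → ℝ) (lam : Fin m → ℝ),
      ((∀ i, eval x (F i) = ∑ j, lam j * eval x (pderiv i (g j))) ∧
        (∀ j ∈ E, eval x (g j) = 0) ∧
        (∀ j ∈ I, 0 ≤ lam j ∧ 0 ≤ eval x (g j) ∧ lam j * eval x (g j) = 0)) →
      lam = lamE x) ∧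
    -- (b) `x` is a KKT point iff it satisfies the system with `λ(x)`
    (∀ x : Fin n → ℝ,
      (∃ lam : Fin m → ℝ,
        (∀ i, eval x (F i) = ∑ j, lam j * eval x (pderiv i (g j))) ∧
        (∀ j ∈ E, eval x (g j) = 0) ∧
        (∀ j ∈ I, 0 ≤ lam j ∧ 0 ≤ eval x (g j) ∧ lam j * eval x (g j) = 0)) ↔
      x ∈ K) ∧
    -- (c) every solution of VI(X,F) is a KKT point
    SOL ⊆ K := by
  have hmul (x : Fin n → ℝ) (lam : Fin m → ℝ)
      (h : (∀ i, eval x (F i) = ∑ j, lam j * eval x (pderiv i (g j))) ∧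
        (∀ j ∈ E, eval x (g j) = 0) ∧
        (∀ j ∈ I, 0 ≤ lam j ∧ 0 ≤ eval x (g j) ∧ lam j * eval x (g j) = 0)) :
      lam = lamE x := by
    obtain ⟨hF, hE, hI⟩ := h
    have hG : Gmat g x *ᵥ lam = Sum.elim (fun i => eval x (F i)) (fun _ => 0) := by
      funext p
      rcases p with i | k
      · rw [Gmat_mulVec_inl, Sum.elim_inl, hF]
      · rw [Gmat_mulVec_inr, Sum.elim_inr]
        rcases (hUnion ▸ Set.mem_univ k : k ∈ E ∪ I) with hk | hk
        · rw [hE k hk, mul_zero]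
        · exact (hI k hk).2.2
    rw [hlamE, ← hG, mulVec_mulVec, hL, one_mulVec]
  refine ⟨hmul, fun x => ⟨?_, ?_⟩, ?_⟩
  · rintro ⟨lam, h⟩
    obtain rfl := hmul x lam h
    rw [hK]
    exact h
  · intro hx
    rw [hK] at hx
    exact ⟨lamE x, hx⟩
  · subst hSOL hX hK
    rintro x ⟨⟨hxI, hxE⟩, hsol⟩
    obtain ⟨hG, hpos⟩ := Gmat_mulVec_multiplier_of_isSolution g x hEI _ (hL x)
      (fun i => eval x (F i)) hxI hxE fun y hyI hyE => hsol y ⟨hyI, hyE⟩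
    have hlam : lamE x = L.map (eval x) *ᵥ Sum.elim (fun i => eval x (F i)) 0 := hlamE x
    rw [← hlam] at hG hpos
    refine ⟨fun i => ?_, hxE, fun j hj => ⟨hpos j hj, hxI j hj, ?_⟩⟩
    · rw [← Gmat_mulVec_inl, hG, Sum.elim_inl]
    · rw [← Gmat_mulVec_inr, hG, Sum.elim_inr, Pi.zero_apply]
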